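/- Degree 2n+1 Yang–Baxter relation for A: let n ≥ 1 and λ₀, λ₁^B,…,λ_n^B, λ₁^C,…,λ_n^C ∈ ℂ be such that all the sinh-denominators occurring below are nonzero. Then, as operators on (ℂ²)^{⊗L}: ∏_{i=1}^{n} [a(λ_i^C−λ₀)/b(λ_i^C−λ₀)] A(λ₀) C(λ_n^C)⋯C(λ₁^C) B(λ₁^B)⋯B(λ_n^B) − ∑_{i=1}^{n} [c(λ_i^C−λ₀)/b(λ_i^C−λ₀)] ∏_{j≠i} [a(λ_j^C−λ_i^C)/b(λ_j^C−λ_i^C)] A(λ_i^C) C(λ_n^C)⋯C(λ_{i+1}^C) C(λ_{i−1}^C)⋯C(λ₁^C) C(λ₀) B(λ₁^B)⋯B(λ_n^B) = ∏_{i=1}^{n} [a(λ_i^B−λ₀)/b(λ_i^B−λ₀)] C(λ_n^C)⋯C(λ₁^C) B(λ₁^B)⋯B(λ_n^B) A(λ₀) − ∑_{i=1}^{n} [c(λ_i^B−λ₀)/b(λ_i^B−λ₀)] ∏_{j≠i} [a(λ_j^B−λ_i^B)/b(λ_j^B−λ_i^B)] C(λ_n^C)⋯C(λ₁^C) B(λ₀)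 B(λ₁^B)⋯B(λ_{i−1}^B) B(λ_{i+1}^B)⋯B(λ_n^B) A(λ_i^B). -/

import Mathlib

noncomputable section

/-- `a(λ) = sinh(λ + γ)` -/
def af (γ lam : ℂ) : ℂ := Complex.sinh (lam + γ)

/-- `b(λ) = sinh(λ)` -/
def bf (lam : ℂ) : ℂ := Complex.sinh lam

/-- `c(λ) = sinh(γ)` (a constant function of `λ`). -/
def cf (γ : ℂ) (_lam : ℂ) : ℂ := Complex.sinh γ

/-- The six-vertex R-matrix on `ℂ² ⊗ ℂ²`, in the ordered basis
`(e₁⊗e₁, e₁⊗e₂, e₂⊗e₁, e₂⊗e₂)` encoded by pairs `(i, j) : Fin 2 × Fin 2`. -/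
def Rmat (γ lam : ℂ) : Matrix (Fin 2 × Fin 2) (Fin 2 × Fin 2) ℂ :=
  fun p q =>
    if p = q then (if p.1 = p.2 then af γ lam else bf lam)
    else if p.1 = q.2 ∧ p.2 = q.1 then cf γ lam else 0

/-- `R_{ai}(λ)` on `ℂ² ⊗ (ℂ²)^{⊗L}`: `R(λ)` on the auxiliary factor and the
`i`-th quantum factor, identity elsewhere.  A vector of the space is indexed by
a pair `(auxiliary index, quantum indices)`. -/
def Rai (γ : ℂ) {L : ℕ} (lam : ℂ) (i : Fin L) :
    Matrix (Fin 2 × (Fin L → Fin 2)) (Fin 2 × (Fin L → Fin 2)) ℂ :=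
  fun p q =>
    Rmat γ lam (p.1, p.2 i) (q.1, q.2 i) *
      (if ∀ k, k ≠ i → p.2 k = q.2 k then 1 else 0)

/-- The monodromy matrix `T(λ) = R_{a1}(λ−μ₁) R_{a2}(λ−μ₂) ⋯ R_{aL}(λ−μ_L)`. -/
def Tmat (γ : ℂ) {L : ℕ} (μ : Fin L → ℂ) (lam : ℂ) :
    Matrix (Fin 2 × (Fin L → Fin 2)) (Fin 2 × (Fin L → Fin 2)) ℂ :=
  (List.ofFn fun i : Fin L => Rai γ (lam - μ i) i).prod

/-- `A(λ)`: the (1,1) block of `T(λ)` with respect to the auxiliary factor. -/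
def Aop (γ : ℂ) {L : ℕ} (μ : Fin L → ℂ) (lam : ℂ) :
    Matrix (Fin L → Fin 2) (Fin L → Fin 2) ℂ :=
  fun p q => Tmat γ μ lam (0, p) (0, q)

/-- `B(λ)`: the (1,2) block of `T(λ)` with respect to the auxiliary factor. -/
def Bop (γ : ℂ) {L : ℕ} (μ : Fin L → ℂ) (lam : ℂ) :
    Matrix (Fin L → Fin 2) (Fin L → Fin 2) ℂ :=
  fun p q => Tmat γ μ lam (0, p) (1, q)

/-- `C(λ)`: the (2,1) block of `T(λ)` with respect to the auxiliary factor. -/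
def Cop (γ : ℂ) {L : ℕ} (μ : Fin L → ℂ) (lam : ℂ) :
    Matrix (Fin L → Fin 2) (Fin L → Fin 2) ℂ :=
  fun p q => Tmat γ μ lam (1, p) (0, q)

/-- `D(λ)`: the (2,2) block of `T(λ)` with respect to the auxiliary factor. -/
def Dop (γ : ℂ) {L : ℕ} (μ : Fin L → ℂ) (lam : ℂ) :
    Matrix (Fin L → Fin 2) (Fin L → Fin 2) ℂ :=
  fun p q => Tmat γ μ lam (1, p) (1, q)

/-- The vector `|0⟩ = e₁^{⊗L}`. -/
def v0 {L : ℕ} : (Fin L → Fin 2) → ℂ :=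
  fun p => if p = (fun _ => 0) then 1 else 0

/-- The vector `|0̄⟩ = e₂^{⊗L}`. -/
def v0bar {L : ℕ} : (Fin L → Fin 2) → ℂ :=
  fun p => if p = (fun _ => 1) then 1 else 0

/-- The ordered product `C(λ_n^C) ⋯ C(λ₁^C)`. -/
def CprodRev (γ : ℂ) {L : ℕ} (μ : Fin L → ℂ) {n : ℕ} (lamC : Fin n → ℂ) :
    Matrix (Fin L → Fin 2) (Fin L → Fin 2) ℂ :=
  ((List.ofFn fun i : Fin n => Cop γ μ (lamC i)).reverse).prod

/-- The ordered product `B(λ₁^B) ⋯ B(λ_n^B)`. -/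
def Bprod (γ : ℂ) {L : ℕ} (μ : Fin L → ℂ) {n : ℕ} (lamB : Fin n → ℂ) :
    Matrix (Fin L → Fin 2) (Fin L → Fin 2) ℂ :=
  (List.ofFn fun i : Fin n => Bop γ μ (lamB i)).prod

/-! ### Generic ring lemma for monodromy products -/

theorem rtt_list {S ι : Type*} [Ring S] (R : S) (P Q : ι → S)
    (hloc : ∀ i, R * P i * Q i = Q i * P i * R)
    (hcom : ∀ i j, i ≠ j → Commute (P i) (Q j)) :
    ∀ l : List ι, l.Nodup →
      R * (l.map P).prod * (l.map Q).prod = (l.map Q).prod * (l.map P).prod * R := by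
  intro l
  induction l with
  | nil => intro _; simp
  | cons x l ih =>
    intro h
    rw [List.nodup_cons] at h
    obtain ⟨hx, hl⟩ := h
    have h1 : Commute ((l.map P).prod) (Q x) := by
      apply Commute.list_prod_left
      intro y hy
      obtain ⟨z, hz, rfl⟩ := List.mem_map.1 hy
      exact hcom z x (by rintro rfl; exact hx hz)
    have h2 : Commute (P x) ((l.map Q).prod) := by
      apply Commute.list_prod_right
      intro y hy
      obtain ⟨z, hz, rfl⟩ := List.mem_map.1 hy
      exact hcom x z (by rintro rfl; exact hx hz)
    have ih' := ih hl
    simp only [List.map_cons, List.prod_cons]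
    set p := (l.map P).prod
    set q := (l.map Q).prod
    calc R * (P x * p) * (Q x * q) = R * P x * (p * Q x) * q := by noncomm_ring
      _ = (R * P x * Q x) * p * q := by rw [h1.eq]; noncomm_ring
      _ = Q x * P x * (R * p * q) := by rw [hloc]; noncomm_ring
      _ = Q x * (P x * q) * p * R := by rw [ih']; noncomm_ring
      _ = Q x * q * (P x * p) * R := by rw [h2.eq]; noncomm_ring

/-! ### Single-site operators -/

/-- A 2x2 matrix acting on site `i`. -/
def siteOp {L : ℕ} (i : Fin L) (e : Matrix (Fin 2) (Fin 2) ℂ) :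
    Matrix (Fin L → Fin 2) (Fin L → Fin 2) ℂ :=
  fun p q => e (p i) (q i) * (if ∀ k, k ≠ i → p k = q k then 1 else 0)

theorem siteOp_mul_apply {L : ℕ} (i : Fin L) (e : Matrix (Fin 2) (Fin 2) ℂ)
    (X : Matrix (Fin L → Fin 2) (Fin L → Fin 2) ℂ) (p q : Fin L → Fin 2) :
    (siteOp i e * X) p q = ∑ s, e (p i) s * X (Function.update p i s) q := by
  rw [Matrix.mul_apply]
  symm
  apply Finset.sum_of_injOn (fun s => Function.update p i s)
  · intro s _ t _ h
    simpa using congrFun h i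
  · intro s _; simp
  · intro r _ hr
    have : ¬ ∀ k, k ≠ i → p k = r k := by
      intro h
      apply hr
      refine ⟨r i, by simp, ?_⟩
      funext k
      by_cases hk : k = i
      · subst hk; simp
      · simp [hk, h k hk]
    simp [siteOp, this]
  · intro s _
    have : ∀ k, k ≠ i → p k = Function.update p i s k := by
      intro k hk; simp [hk]
    simp only [siteOp, Function.update_self]
    rw [if_pos this]; simp

theorem siteOp_comm {L : ℕ} (i j : Fin L) (hij : i ≠ j) (e f : Matrix (Fin 2) (Fin 2) ℂ) :
    siteOp i e * siteOp j f = siteOp j f * siteOp i e := by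
  rw [← mul_one (siteOp i e * siteOp j f), ← mul_one (siteOp j f * siteOp i e),
    mul_assoc, mul_assoc]
  ext p q
  simp only [siteOp_mul_apply, Finset.mul_sum]
  rw [Finset.sum_comm]
  refine Finset.sum_congr rfl fun s _ => Finset.sum_congr rfl fun t _ => ?_
  rw [Function.update_of_ne hij.symm, Function.update_of_ne hij, Function.update_comm hij]
  ring

theorem siteOp_mul {L : ℕ} (i : Fin L) (e f : Matrix (Fin 2) (Fin 2) ℂ) :
    siteOp i e * siteOp i f = siteOp i (e * f) := by
  rw [← mul_one (siteOp i e * siteOp i f), ← mul_one (siteOp i (e * f)), mul_assoc]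
  ext p q
  simp only [siteOp_mul_apply, Function.update_self]
  simp only [Matrix.mul_apply, Finset.mul_sum, Finset.sum_mul]
  rw [Finset.sum_comm]
  refine Finset.sum_congr rfl fun s _ => Finset.sum_congr rfl fun t _ => ?_
  have hu : Function.update (Function.update p i t) i s = Function.update p i s := by
    funext k
    by_cases hk : k = i
    · subst hk; simp
    · simp [hk]
  rw [hu]
  ring

theorem siteOp_add {L : ℕ} (i : Fin L) (e f : Matrix (Fin 2) (Fin 2) ℂ) :
    siteOp i (e + f) = siteOp i e + siteOp i f := by
  ext p q; simp [siteOp, add_mul]; split_ifs <;> simp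

theorem siteOp_smul {L : ℕ} (i : Fin L) (c : ℂ) (e : Matrix (Fin 2) (Fin 2) ℂ) :
    siteOp i (c • e) = c • siteOp i e := by
  ext p q; simp [siteOp, mul_assoc]

/-- Linear map version. -/
def siteLin {L : ℕ} (i : Fin L) : Matrix (Fin 2) (Fin 2) ℂ →ₗ[ℂ]
    Matrix (Fin L → Fin 2) (Fin L → Fin 2) ℂ where
  toFun := siteOp i
  map_add' := siteOp_add i
  map_smul' := siteOp_smul i

/-- The local block of the R-matrix. -/
def Lloc (γ lam : ℂ) (k m : Fin 2) : Matrix (Fin 2) (Fin 2) ℂ :=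
  fun p q => Rmat γ lam (k, p) (m, q)

/-! ### The local relation -/

set_option maxHeartbeats 4000000 in
theorem local_ybe (γ u v : ℂ) (i j m n p q : Fin 2) :
    ∑ k, ∑ l, Rmat γ (u - v) (i, j) (k, l) *
        ∑ t, Rmat γ u (k, p) (m, t) * Rmat γ v (l, t) (n, q)
      = ∑ k, ∑ l, Rmat γ (u - v) (k, l) (m, n) *
        ∑ t, Rmat γ v (j, p) (l, t) * Rmat γ u (i, t) (k, q) := by
  obtain ⟨w, rfl⟩ : ∃ w, u = w + v := ⟨u - v, by ring⟩
  have hw : w + v - v = w := by ring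
  rw [hw]
  have n1 := Complex.exp_ne_zero w
  have n2 := Complex.exp_ne_zero v
  have n3 := Complex.exp_ne_zero γ
  fin_cases i <;> fin_cases j <;> fin_cases m <;> fin_cases n <;> fin_cases p <;> fin_cases q <;>
    simp [Rmat, Fin.sum_univ_two, -mul_eq_mul_left_iff, -mul_eq_mul_right_iff] <;> try ring1
  all_goals
    simp only [af, bf, cf, Complex.sinh, neg_add, Complex.exp_add, Complex.exp_neg]
    field_simp
    ring1

/-! ### Exchange of `A` through a string of `B`s in an abstract algebra -/

theorem prod_erase_ite {n : ℕ} (i : Fin n) (F : Fin n → ℂ) :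
    ∏ j ∈ Finset.univ.erase i, F j = ∏ j, if j = i then 1 else F j := by
  rw [← Finset.filter_ne', Finset.prod_filter]
  refine Finset.prod_congr rfl fun j _ => ?_
  by_cases h : j = i <;> simp [h]

theorem prod_erase_zero {n : ℕ} (F : Fin (n + 1) → ℂ) :
    ∏ j ∈ Finset.univ.erase 0, F j = ∏ j : Fin n, F j.succ := by
  rw [prod_erase_ite, Fin.prod_univ_succ]
  simp [Fin.succ_ne_zero]

theorem prod_erase_succ {n : ℕ} (i : Fin n) (F : Fin (n + 1) → ℂ) :
    ∏ j ∈ Finset.univ.erase i.succ, F j = F 0 * ∏ j ∈ Finset.univ.erase i, F j.succ := by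
  rw [prod_erase_ite, Fin.prod_univ_succ, prod_erase_ite]
  simp [(Fin.succ_ne_zero _).symm]

theorem coeff_identity (γ l0 l1 li : ℂ) (h1 : bf (l1 - l0) ≠ 0) (h2 : bf (li - l0) ≠ 0)
    (h3 : bf (l1 - li) ≠ 0) :
    af γ (l1 - l0) / bf (l1 - l0) * (cf γ (li - l0) / bf (li - l0))
      - cf γ (l1 - l0) / bf (l1 - l0) * (cf γ (li - l1) / bf (li - l1))
    = cf γ (li - l0) / bf (li - l0) * (af γ (l1 - li) / bf (l1 - li)) := by
  have h4 : bf (li - l1) = - bf (l1 - li) := by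
    unfold bf; rw [← Complex.sinh_neg]; congr 1; ring
  rw [h4]
  have key : af γ (l1 - l0) * bf (l1 - li) + cf γ 0 * bf (li - l0)
      = af γ (l1 - li) * bf (l1 - l0) := by
    obtain ⟨x, rfl⟩ : ∃ x, l1 = x + l0 := ⟨l1 - l0, by ring⟩
    obtain ⟨y, rfl⟩ : ∃ y, li = y + l0 := ⟨li - l0, by ring⟩
    have n1 := Complex.exp_ne_zero x
    have n2 := Complex.exp_ne_zero y
    have n3 := Complex.exp_ne_zero γ
    rw [show x + l0 - l0 = x by ring, show y + l0 - l0 = y by ring,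
      show x + l0 - (y + l0) = x + -y by ring]
    simp only [af, bf, cf, Complex.sinh, neg_add, Complex.exp_add, Complex.exp_neg, neg_neg]
    field_simp
    ring1
  have hc : ∀ z, cf γ z = cf γ 0 := fun _ => rfl
  rw [hc (li - l0), hc (l1 - l0), hc (li - l1)]
  field_simp
  linear_combination cf γ 0 * key

theorem exchange_string {M : Type*} [Ring M] [Algebra ℂ M] (γ : ℂ) (A B : ℂ → M)
    (hAB : ∀ x y, bf (y - x) • (A x * B y) =
      af γ (y - x) • (B y * A x) - cf γ (y - x) • (B x * A y))
    (hB : ∀ x y, B x * B y = B y * B x) :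
    ∀ (n : ℕ) (lam0 : ℂ) (lam : Fin n → ℂ)
      (_ : ∀ i, bf (lam i - lam0) ≠ 0)
      (_ : ∀ i j, j ≠ i → bf (lam j - lam i) ≠ 0),
      A lam0 * (List.ofFn fun i => B (lam i)).prod =
        (∏ i, af γ (lam i - lam0) / bf (lam i - lam0)) •
          ((List.ofFn fun i => B (lam i)).prod * A lam0)
        - ∑ i, ((cf γ (lam i - lam0) / bf (lam i - lam0)) *
            ∏ j ∈ Finset.univ.erase i, af γ (lam j - lam i) / bf (lam j - lam i)) •
          ((B lam0 :: (List.ofFn fun j : Fin n => B (lam j)).eraseIdx (i : ℕ)).prod *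
            A (lam i)) := by
  intro n
  induction n with
  | zero => intro lam0 lam _ _; simp
  | succ n ih =>
    intro lam0 lam h0 hd
    have ih0 := ih lam0 (fun i => lam i.succ) (fun i => h0 _)
      (fun i j hij => hd _ _ (by simpa using hij))
    have ih1 := ih (lam 0) (fun i => lam i.succ) (fun i => hd _ _ (Fin.succ_ne_zero i))
      (fun i j hij => hd _ _ (by simpa using hij))
    have hab : A lam0 * B (lam 0) = (af γ (lam 0 - lam0) / bf (lam 0 - lam0)) • (B (lam 0) * A lam0)
        - (cf γ (lam 0 - lam0) / bf (lam 0 - lam0)) • (B lam0 * A (lam 0)) := by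
      have hb := h0 0
      have := congrArg (fun z => (bf (lam 0 - lam0))⁻¹ • z) (hAB lam0 (lam 0))
      simp only [smul_smul, smul_sub, inv_mul_cancel₀ hb, one_smul] at this
      rw [this, div_eq_inv_mul, div_eq_inv_mul]
    rw [Fin.sum_univ_succ, Fin.prod_univ_succ, prod_erase_zero]
    simp only [prod_erase_succ, List.ofFn_succ, List.prod_cons, Fin.val_zero, Fin.val_succ,
      List.eraseIdx_cons_zero, List.eraseIdx_cons_succ]
    rw [← mul_assoc, hab, sub_mul, smul_mul_assoc, smul_mul_assoc, mul_assoc, mul_assoc, ih0, ih1]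
    simp only [List.prod_cons, mul_sub, smul_sub, mul_smul_comm, smul_smul, Finset.mul_sum,
      Finset.smul_sum, mul_assoc]
    have key : ∀ i : Fin n,
        (cf γ (lam i.succ - lam0) / bf (lam i.succ - lam0) *
            (af γ (lam 0 - lam i.succ) / bf (lam 0 - lam i.succ) *
              ∏ j ∈ Finset.univ.erase i,
                af γ (lam j.succ - lam i.succ) / bf (lam j.succ - lam i.succ))) •
          (B lam0 * (B (lam 0) * (((List.ofFn fun j : Fin n => B (lam j.succ)).eraseIdx i).prod *
            A (lam i.succ))))
        = (af γ (lam 0 - lam0) / bf (lam 0 - lam0) *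
            (cf γ (lam i.succ - lam0) / bf (lam i.succ - lam0) *
              ∏ j ∈ Finset.univ.erase i,
                af γ (lam j.succ - lam i.succ) / bf (lam j.succ - lam i.succ))) •
          (B (lam 0) * (B lam0 * (((List.ofFn fun j : Fin n => B (lam j.succ)).eraseIdx i).prod *
            A (lam i.succ))))
        - (cf γ (lam 0 - lam0) / bf (lam 0 - lam0) *
            (cf γ (lam i.succ - lam 0) / bf (lam i.succ - lam 0) *
              ∏ j ∈ Finset.univ.erase i,
                af γ (lam j.succ - lam i.succ) / bf (lam j.succ - lam i.succ))) •
          (B lam0 * (B (lam 0) * (((List.ofFn fun j : Fin n => B (lam j.succ)).eraseIdx i).prod *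
            A (lam i.succ)))) := by
      intro i
      rw [← mul_assoc (B (lam 0)) (B lam0), hB (lam 0) lam0, mul_assoc (B lam0), ← sub_smul]
      congr 1
      have := coeff_identity γ lam0 (lam 0) (lam i.succ) (h0 0) (h0 _)
        (hd _ _ (Fin.succ_ne_zero i).symm)
      rw [← mul_assoc, ← this]
      ring
    simp only [key, Finset.sum_sub_distrib]
    abel

/-! ### RTT relation -/

section Emb
variable {M : Type*} [Ring M]

/-- Embedding in the first auxiliary space. -/
def emb1 : Matrix (Fin 2) (Fin 2) M →* Matrix (Fin 2 × Fin 2) (Fin 2 × Fin 2) M where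
  toFun X := Matrix.of fun p q => if p.2 = q.2 then X p.1 q.1 else 0
  map_one' := by
    ext ⟨i, j⟩ ⟨k, l⟩
    simp only [Matrix.one_apply, Prod.mk.injEq]
    by_cases h : j = l <;> by_cases h' : i = k <;> simp [h, h']
  map_mul' X Y := by
    ext ⟨i, j⟩ ⟨k, l⟩
    by_cases h : j = l <;> simp [Matrix.mul_apply, Fintype.sum_prod_type, h]

/-- Embedding in the second auxiliary space. -/
def emb2 : Matrix (Fin 2) (Fin 2) M →* Matrix (Fin 2 × Fin 2) (Fin 2 × Fin 2) M where
  toFun X := Matrix.of fun p q => if p.1 = q.1 then X p.2 q.2 else 0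
  map_one' := by
    ext ⟨i, j⟩ ⟨k, l⟩
    simp only [Matrix.one_apply, Prod.mk.injEq]
    by_cases h : j = l <;> by_cases h' : i = k <;> simp [h, h']
  map_mul' X Y := by
    ext ⟨i, j⟩ ⟨k, l⟩
    by_cases h : i = k <;> simp [Matrix.mul_apply, Fintype.sum_prod_type_right, h]

theorem emb1_apply (X : Matrix (Fin 2) (Fin 2) M) (p q : Fin 2 × Fin 2) :
    emb1 X p q = if p.2 = q.2 then X p.1 q.1 else 0 := rfl

theorem emb2_apply (X : Matrix (Fin 2) (Fin 2) M) (p q : Fin 2 × Fin 2) :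
    emb2 X p q = if p.1 = q.1 then X p.2 q.2 else 0 := rfl

theorem emb12 (X Y : Matrix (Fin 2) (Fin 2) M) (i j k l : Fin 2) :
    (emb1 X * emb2 Y) (i, j) (k, l) = X i k * Y j l := by
  rw [Matrix.mul_apply, Fintype.sum_prod_type]
  simp only [emb1_apply, emb2_apply]
  fin_cases i <;> fin_cases j <;> fin_cases k <;> fin_cases l <;> simp [Fin.sum_univ_two]

theorem emb21 (X Y : Matrix (Fin 2) (Fin 2) M) (i j k l : Fin 2) :
    (emb2 Y * emb1 X) (i, j) (k, l) = Y j l * X i k := by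
  rw [Matrix.mul_apply, Fintype.sum_prod_type]
  simp only [emb1_apply, emb2_apply]
  fin_cases i <;> fin_cases j <;> fin_cases k <;> fin_cases l <;> simp [Fin.sum_univ_two]

end Emb

/-- The auxiliary blocks of an operator. -/
def blk {L : ℕ} : Matrix (Fin 2 × (Fin L → Fin 2)) (Fin 2 × (Fin L → Fin 2)) ℂ →*
    Matrix (Fin 2) (Fin 2) (Matrix (Fin L → Fin 2) (Fin L → Fin 2) ℂ) where
  toFun X := Matrix.of fun s t => Matrix.of fun p q => X (s, p) (t, q)
  map_one' := by
    ext s t p q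
    by_cases h : s = t <;> by_cases h' : p = q <;> simp [Matrix.one_apply, h, h']
  map_mul' X Y := by
    ext s t p q
    simp [Matrix.mul_apply, Fintype.sum_prod_type, Matrix.add_apply]

theorem blk_Rai (γ : ℂ) {L : ℕ} (lam : ℂ) (i : Fin L) (k m : Fin 2) :
    blk (Rai γ lam i) k m = siteOp i (Lloc γ lam k m) := rfl

theorem local_rtt (γ u v : ℂ) {L : ℕ} (s : Fin L) (i j m n : Fin 2) :
    ∑ k, ∑ l, Rmat γ (u - v) (i, j) (k, l) • (siteOp s (Lloc γ u k m) * siteOp s (Lloc γ v l n))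
      = ∑ k, ∑ l, Rmat γ (u - v) (k, l) (m, n) •
        (siteOp s (Lloc γ v j l) * siteOp s (Lloc γ u i k)) := by
  have h : ∑ k, ∑ l, Rmat γ (u - v) (i, j) (k, l) • (Lloc γ u k m * Lloc γ v l n)
      = ∑ k, ∑ l, Rmat γ (u - v) (k, l) (m, n) • (Lloc γ v j l * Lloc γ u i k) := by
    ext p q
    simp only [Matrix.sum_apply, Matrix.smul_apply, Matrix.mul_apply, smul_eq_mul]
    exact local_ybe γ u v i j m n p q
  have h' := congrArg (siteLin s) h
  simp only [map_sum, map_smul] at h'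
  simp only [siteOp_mul]
  exact h'

theorem rtt (γ : ℂ) {L : ℕ} (μ : Fin L → ℂ) (u v : ℂ) (i j m n : Fin 2) :
    ∑ k, ∑ l, Rmat γ (u - v) (i, j) (k, l) • (blk (Tmat γ μ u) k m * blk (Tmat γ μ v) l n)
      = ∑ k, ∑ l, Rmat γ (u - v) (k, l) (m, n) •
        (blk (Tmat γ μ v) j l * blk (Tmat γ μ u) i k) := by
  set R : Matrix (Fin 2 × Fin 2) (Fin 2 × Fin 2) (Matrix (Fin L → Fin 2) (Fin L → Fin 2) ℂ) :=
    fun p q => algebraMap ℂ _ (Rmat γ (u - v) p q) with hR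
  have hl : ∀ (X Y : Matrix (Fin 2) (Fin 2) (Matrix (Fin L → Fin 2) (Fin L → Fin 2) ℂ))
      (i j m n : Fin 2), (R * emb1 X * emb2 Y) (i, j) (m, n) =
        ∑ k, ∑ l, Rmat γ (u - v) (i, j) (k, l) • (X k m * Y l n) := by
    intro X Y i j m n
    rw [mul_assoc, Matrix.mul_apply, Fintype.sum_prod_type]
    refine Finset.sum_congr rfl fun k _ => Finset.sum_congr rfl fun l _ => ?_
    rw [emb12, hR, Algebra.smul_def]
  have hr : ∀ (X Y : Matrix (Fin 2) (Fin 2) (Matrix (Fin L → Fin 2) (Fin L → Fin 2) ℂ))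
      (i j m n : Fin 2), (emb2 Y * emb1 X * R) (i, j) (m, n) =
        ∑ k, ∑ l, Rmat γ (u - v) (k, l) (m, n) • (Y j l * X i k) := by
    intro X Y i j m n
    rw [Matrix.mul_apply, Fintype.sum_prod_type]
    refine Finset.sum_congr rfl fun k _ => Finset.sum_congr rfl fun l _ => ?_
    rw [emb21, hR, Algebra.smul_def, Algebra.commutes]
  have main := rtt_list R (fun s : Fin L => emb1 (blk (Rai γ (u - μ s) s)))
    (fun s : Fin L => emb2 (blk (Rai γ (v - μ s) s)))
    (by
      intro s
      ext1 ⟨i, j⟩ ⟨m, n⟩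
      rw [hl, hr]
      simp only [blk_Rai]
      have := local_rtt γ (u - μ s) (v - μ s) s i j m n
      rwa [show u - μ s - (v - μ s) = u - v by ring] at this)
    (by
      intro s t hst
      show _ * _ = _ * _
      ext1 ⟨i, j⟩ ⟨m, n⟩
      rw [emb12, emb21]
      simp only [blk_Rai]
      exact siteOp_comm _ _ hst _ _)
    (List.finRange L) (List.nodup_finRange L)
  have hp : ∀ w, ((List.finRange L).map fun s : Fin L => emb1 (blk (Rai γ (w - μ s) s))).prod
      = emb1 (blk (Tmat γ μ w)) := by
    intro w
    rw [Tmat, map_list_prod, map_list_prod, List.ofFn_eq_map, List.map_map, List.map_map]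
    rfl
  have hq : ∀ w, ((List.finRange L).map fun s : Fin L => emb2 (blk (Rai γ (w - μ s) s))).prod
      = emb2 (blk (Tmat γ μ w)) := by
    intro w
    rw [Tmat, map_list_prod, map_list_prod, List.ofFn_eq_map, List.map_map, List.map_map]
    rfl
  rw [hp, hq] at main
  have := congrFun (congrFun main (i, j)) (m, n)
  rwa [hl, hr] at this

theorem rel_AB (γ : ℂ) {L : ℕ} (μ : Fin L → ℂ) (x y : ℂ) :
    bf (y - x) • (Aop γ μ x * Bop γ μ y) =
      af γ (y - x) • (Bop γ μ y * Aop γ μ x) - cf γ (y - x) • (Bop γ μ x * Aop γ μ y) := by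
  have := rtt γ μ y x 0 0 1 0
  simp [Rmat, Fin.sum_univ_two] at this
  change af γ (y - x) • (Bop γ μ y * Aop γ μ x) = cf γ (y - x) • (Bop γ μ x * Aop γ μ y)
    + bf (y - x) • (Aop γ μ x * Bop γ μ y) at this
  rw [this]; abel

theorem rel_CA (γ : ℂ) {L : ℕ} (μ : Fin L → ℂ) (x y : ℂ) :
    bf (y - x) • (Cop γ μ y * Aop γ μ x) =
      af γ (y - x) • (Aop γ μ x * Cop γ μ y) - cf γ (y - x) • (Aop γ μ y * Cop γ μ x) := by
  have := rtt γ μ y x 1 0 0 0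
  simp [Rmat, Fin.sum_univ_two] at this
  change cf γ (y - x) • (Aop γ μ y * Cop γ μ x) + bf (y - x) • (Cop γ μ y * Aop γ μ x)
    = af γ (y - x) • (Aop γ μ x * Cop γ μ y) at this
  rw [← this]; abel

/-! ### Commutativity of `B`s and `C`s, by continuity in `γ` -/

theorem continuous_Tmat {L : ℕ} (μ : Fin L → ℂ) (x : ℂ) :
    Continuous fun γ : ℂ => Tmat γ μ x := by
  unfold Tmat
  simp only [List.ofFn_eq_map]
  apply continuous_list_prod
  intro i _
  refine continuous_matrix fun p q => ?_
  unfold Rai Rmat af bf cf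
  refine Continuous.mul ?_ continuous_const
  split_ifs <;> first | exact continuous_const | fun_prop

theorem comm_of_generic {L : ℕ} (F : ℂ → Matrix (Fin L → Fin 2) (Fin L → Fin 2) ℂ)
    (G : ℂ → Matrix (Fin L → Fin 2) (Fin L → Fin 2) ℂ) (hF : Continuous F) (hG : Continuous G)
    (z : ℂ) (h : ∀ γ, af γ z • F γ = af γ z • G γ) (γ : ℂ) : F γ = G γ := by
  by_cases h0 : af γ z = 0
  · have hd : HasDerivAt (fun g : ℂ => af g z) (Complex.cosh (z + γ)) γ := by
      simpa [af] using ((hasDerivAt_id γ).const_add z).csinh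
    have hne : Complex.cosh (z + γ) ≠ 0 := by
      intro hc
      have := Complex.cosh_sq_sub_sinh_sq (z + γ)
      rw [hc, show Complex.sinh (z + γ) = 0 from h0] at this
      simp at this
    have hev := hd.eventually_ne (c := 0) hne
    have h1 : Filter.Tendsto F (nhdsWithin γ {γ}ᶜ) (nhds (F γ)) :=
      hF.continuousAt.tendsto.mono_left nhdsWithin_le_nhds
    have h2 : Filter.Tendsto G (nhdsWithin γ {γ}ᶜ) (nhds (G γ)) :=
      hG.continuousAt.tendsto.mono_left nhdsWithin_le_nhds
    refine tendsto_nhds_unique_of_eventuallyEq h1 h2 ?_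
    filter_upwards [hev] with g hg
    exact smul_right_injective _ hg (h g)
  · exact smul_right_injective _ h0 (h γ)

theorem continuous_blk {L : ℕ} (μ : Fin L → ℂ) (x : ℂ) (s t : Fin 2) :
    Continuous fun γ : ℂ => blk (Tmat γ μ x) s t := by
  refine continuous_matrix fun p q => ?_
  exact (continuous_Tmat μ x).matrix_elem (s, p) (t, q)

theorem comm_B (γ : ℂ) {L : ℕ} (μ : Fin L → ℂ) (x y : ℂ) :
    Bop γ μ x * Bop γ μ y = Bop γ μ y * Bop γ μ x := by
  refine comm_of_generic (fun γ => blk (Tmat γ μ x) 0 1 * blk (Tmat γ μ y) 0 1)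
    (fun γ => blk (Tmat γ μ y) 0 1 * blk (Tmat γ μ x) 0 1)
    ((continuous_blk μ x 0 1).mul (continuous_blk μ y 0 1))
    ((continuous_blk μ y 0 1).mul (continuous_blk μ x 0 1)) (x - y) ?_ γ
  intro γ
  have := rtt γ μ x y 0 0 1 1
  simpa [Rmat, Fin.sum_univ_two] using this

theorem comm_C (γ : ℂ) {L : ℕ} (μ : Fin L → ℂ) (x y : ℂ) :
    Cop γ μ x * Cop γ μ y = Cop γ μ y * Cop γ μ x := by
  refine comm_of_generic (fun γ => blk (Tmat γ μ x) 1 0 * blk (Tmat γ μ y) 1 0)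
    (fun γ => blk (Tmat γ μ y) 1 0 * blk (Tmat γ μ x) 1 0)
    ((continuous_blk μ x 1 0).mul (continuous_blk μ y 1 0))
    ((continuous_blk μ y 1 0).mul (continuous_blk μ x 1 0)) (x - y) ?_ γ
  intro γ
  have := rtt γ μ x y 1 1 0 0
  simpa [Rmat, Fin.sum_univ_two] using this

open MulOpposite in
theorem unop_prod_list {M : Type*} [Ring M] (l : List M) :
    unop (l.map op).prod = l.reverse.prod := by
  rw [MulOpposite.unop_list_prod]
  simp

theorem eraseIdx_map_op {M : Type*} [Ring M] (l : List M) (i : ℕ) :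
    (l.map MulOpposite.op).eraseIdx i = (l.eraseIdx i).map MulOpposite.op := by
  rw [List.eraseIdx_map]

/-- Degree `2n+1` Yang–Baxter relation obtained by commuting `A(λ₀)` through
the strings of `C`'s and `B`'s. -/
theorem degree_2n1_relation_A (γ : ℂ) (L : ℕ) (hL : 1 ≤ L) (μ : Fin L → ℂ)
    (n : ℕ) (hn : 1 ≤ n) (lam0 : ℂ) (lamB lamC : Fin n → ℂ)
    (hC0 : ∀ i, bf (lamC i - lam0) ≠ 0)
    (hB0 : ∀ i, bf (lamB i - lam0) ≠ 0)
    (hCC : ∀ i j, j ≠ i → bf (lamC j - lamC i) ≠ 0)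
    (hBB : ∀ i j, j ≠ i → bf (lamB j - lamB i) ≠ 0) :
    (∏ i, af γ (lamC i - lam0) / bf (lamC i - lam0)) •
        (Aop γ μ lam0 * CprodRev γ μ lamC * Bprod γ μ lamB)
      - ∑ i, ((cf γ (lamC i - lam0) / bf (lamC i - lam0)) *
            ∏ j ∈ Finset.univ.erase i, af γ (lamC j - lamC i) / bf (lamC j - lamC i)) •
          (Aop γ μ (lamC i) *
            ((Cop γ μ lam0 :: (List.ofFn fun j : Fin n => Cop γ μ (lamC j)).eraseIdx
                (i : ℕ)).reverse).prod *
            Bprod γ μ lamB)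
    = (∏ i, af γ (lamB i - lam0) / bf (lamB i - lam0)) •
        (CprodRev γ μ lamC * Bprod γ μ lamB * Aop γ μ lam0)
      - ∑ i, ((cf γ (lamB i - lam0) / bf (lamB i - lam0)) *
            ∏ j ∈ Finset.univ.erase i, af γ (lamB j - lamB i) / bf (lamB j - lamB i)) •
          (CprodRev γ μ lamC *
            (Bop γ μ lam0 :: (List.ofFn fun j : Fin n => Bop γ μ (lamB j)).eraseIdx
                (i : ℕ)).prod *
            Aop γ μ (lamB i)) := by
  have hR := exchange_string γ (Aop γ μ) (Bop γ μ) (rel_AB γ μ) (comm_B γ μ) n lam0 lamB hB0 hBB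
  have hL' := exchange_string γ (fun x => MulOpposite.op (Aop γ μ x))
    (fun x => MulOpposite.op (Cop γ μ x))
    (by
      intro x y
      have := congrArg MulOpposite.op (rel_CA γ μ x y)
      simpa using this)
    (by
      intro x y
      simp only [← MulOpposite.op_mul, comm_C γ μ x y])
    n lam0 lamC hC0 hCC
  have hofn : (List.ofFn fun i => MulOpposite.op (Cop γ μ (lamC i)))
      = (List.ofFn fun i => Cop γ μ (lamC i)).map MulOpposite.op := by
    rw [List.map_ofFn]; rfl
  have hL2 := congrArg MulOpposite.unop hL'
  simp only [hofn, eraseIdx_map_op, ← List.map_cons, MulOpposite.unop_sub, MulOpposite.unop_smul,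
    Finset.unop_sum, MulOpposite.unop_mul, unop_prod_list, MulOpposite.unop_op] at hL2
  have e1 := congrArg (fun z => z * Bprod γ μ lamB) hL2
  have e2 := congrArg (fun z => CprodRev γ μ lamC * z) hR
  simp only [sub_mul, mul_sub, Finset.sum_mul, Finset.mul_sum, smul_mul_assoc, mul_smul_comm]
    at e1 e2
  unfold CprodRev Bprod at *
  simp only [mul_assoc] at e1 e2 ⊢
  rw [← e1, ← e2]

end
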